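/- arXiv:math/0209061 — 9 statements merged into one kernel-verified Lean document; each statement's English description precedes it below -/
import Mathlib

section
/- Let p and q be positive integers, let α : Fin p → Fin q be a monotone (nondecreasing) function and let β : Fin q → Fin p be a monotone (nondecreasing) function. Then the graph of α and the graph of β intersect: there exist i ∈ Fin p and j ∈ Fin q with α i = j and β j = i. -/
/-- A monotone self-map of a finite partial order with a least element has a fixed point. -/
theorem Monotone.exists_isFixedPt_of_finite {γ : Type*} [PartialOrder γ] [OrderBot γ] [Finite γ]
    {f : γ → γ} (hf : Monotone f) : ∃ x, Function.IsFixedPt f x := by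
  obtain ⟨x, hx⟩ := (Set.toFinite {x | x ≤ f x}).exists_maximal ⟨⊥, bot_le⟩
  exact ⟨x, (hx.le_of_ge (hf hx.prop) hx.prop).antisymm hx.prop⟩

/-- Any horizontal path must intersect any vertical path: if `α : Fin p → Fin q`
and `β : Fin q → Fin p` are nondecreasing, their graphs intersect. -/
theorem vertical_path_meets_horizontal_path (p q : ℕ) (hp : 0 < p) (hq : 0 < q)
    (α : Fin p → Fin q) (β : Fin q → Fin p)
    (hα : Monotone α) (hβ : Monotone β) :
    ∃ (i : Fin p) (j : Fin q), α i = j ∧ β j = i := by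
  have : NeZero p := ⟨hp.ne'⟩
  obtain ⟨i, hi⟩ := (hβ.comp hα).exists_isFixedPt_of_finite
  exact ⟨i, α i, rfl, hi⟩
end

section
/- Let p and q be positive integers and let F be any subset of Fin p × Fin q. Then either F contains the graph of some nondecreasing function β : Fin q → Fin p (a horizontal path), or the complement of F contains the graph of some nondecreasing function α : Fin p → Fin q (a vertical path). -/
/-- Greedy form of the dichotomy: a horizontal path in `F` that stays weakly above row `r`,
or a nondecreasing function whose graph avoids `F` in all rows from `r` on. -/
theorem exists_monotone_mem_or_exists_monotone_notMem (p q : ℕ) (F : Set (Fin p × Fin q))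
    (r : Fin p) :
    (∃ β : Fin q → Fin p, Monotone β ∧ (∀ j, r ≤ β j) ∧ ∀ j, (β j, j) ∈ F) ∨
    (∃ α : Fin p → Fin q, Monotone α ∧ ∀ i, r ≤ i → (i, α i) ∉ F) := by
  induction q generalizing r with
  | zero => exact Or.inl ⟨fun j => j.elim0, fun j => j.elim0, fun j => j.elim0, fun j => j.elim0⟩
  | succ q ih =>
    by_cases h : ∃ s, r ≤ s ∧ (s, (0 : Fin (q + 1))) ∈ F
    · obtain ⟨s, ⟨hrs, hsF⟩, hmin⟩ := WellFounded.has_min (wellFounded_lt (α := Fin p))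
        {s | r ≤ s ∧ (s, (0 : Fin (q + 1))) ∈ F} h
      rcases ih {x | (x.1, x.2.succ) ∈ F} s with ⟨β, hβ, hsβ, hβF⟩ | ⟨α, hα, hαF⟩
      · refine Or.inl ⟨Fin.cons s β, ?_, ?_, ?_⟩
        · intro a b hab
          induction a using Fin.cases with
          | zero =>
            induction b using Fin.cases with
            | zero => exact le_rfl
            | succ b => simpa using hsβ b
          | succ a =>
            induction b using Fin.cases with
            | zero => simp at hab
            | succ b => simpa using hβ (Fin.succ_le_succ_iff.mp hab)
        · exact Fin.cases hrs fun j => hrs.trans (hsβ j)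
        · exact Fin.cases hsF hβF
      · refine Or.inr ⟨fun i => if i < s then 0 else (α i).succ, ?_, ?_⟩
        · intro a b hab
          dsimp only
          split_ifs with ha hb hb
          · exact le_rfl
          · exact Fin.zero_le _
          · exact absurd (hab.trans_lt hb) ha
          · exact Fin.succ_le_succ_iff.mpr (hα hab)
        · intro i hi
          dsimp only
          split_ifs with his
          · exact fun hiF => hmin i ⟨hi, hiF⟩ his
          · exact hαF i (not_lt.mp his)
    · exact Or.inr ⟨fun _ => 0, monotone_const, fun i hi hiF => h ⟨i, hi, hiF⟩⟩

/-- For any subset `F` of the grid `Fin p × Fin q`, either `F` contains a horizontal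
path (the graph of a nondecreasing `β : Fin q → Fin p`), or the complement of `F`
contains a vertical path (the graph of a nondecreasing `α : Fin p → Fin q`). -/
theorem horizontal_path_or_complement_vertical_path (p q : ℕ) (hp : 0 < p) (hq : 0 < q)
    (F : Set (Fin p × Fin q)) :
    (∃ β : Fin q → Fin p, Monotone β ∧ ∀ j : Fin q, (β j, j) ∈ F) ∨
    (∃ α : Fin p → Fin q, Monotone α ∧ ∀ i : Fin p, (i, α i) ∉ F) := by
  rcases exists_monotone_mem_or_exists_monotone_notMem p q F ⟨0, hp⟩ with
    ⟨β, hβ, -, hβF⟩ | ⟨α, hα, hαF⟩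
  · exact Or.inl ⟨β, hβ, hβF⟩
  · exact Or.inr ⟨α, hα, fun i => hαF i (Nat.zero_le _)⟩
end

section
/- Let p and q be positive integers and let F be a subset of Fin p × Fin q. Then F contains no vertical path (i.e., for every nondecreasing α : Fin p → Fin q the graph of α is not contained in F) if and only if the complement of F contains a horizontal path (i.e., there is a nondecreasing β : Fin q → Fin p whose graph is contained in the complement of F). -/
/-- A monotone self-map of a nonempty finite chain has a fixed point. -/
theorem Monotone.exists_fixedPoint_of_finite {X : Type*} [LinearOrder X] [Finite X] [Nonempty X]
    {f : X → X} (hf : Monotone f) : ∃ x, f x = x := by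
  obtain ⟨b, hb⟩ := Finite.exists_max (id : X → X)
  obtain ⟨x, hx, hmin⟩ := Set.exists_min_image {x | f x ≤ x} id (Set.toFinite _) ⟨b, hb (f b)⟩
  exact ⟨x, le_antisymm hx (hmin (f x) (hf hx))⟩

/-- The greedy construction of a vertical path in the first `p` rows of `R`: for some column
`t ≤ q` there is a horizontal path avoiding `R` over the first `t` columns and, if `t < q`,
a vertical path in `R` that stays within the columns up to `t`. -/
theorem exists_horizontal_prefix_and_vertical_path (R : ℕ → ℕ → Prop) (p q : ℕ) :
    ∃ t ≤ q,
      (∃ β : ℕ → ℕ, (∀ j k, j ≤ k → k < t → β j ≤ β k) ∧ ∀ j < t, β j < p ∧ ¬ R (β j) j) ∧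
      (t < q → ∃ α : ℕ → ℕ,
        (∀ i k, i ≤ k → k < p → α i ≤ α k) ∧ ∀ i < p, α i ≤ t ∧ R i (α i)) := by
  classical
  induction p with
  | zero => exact ⟨0, q.zero_le, ⟨id, by simp⟩, fun _ => ⟨id, by simp⟩⟩
  | succ p ih =>
    obtain ⟨t, htq, ⟨β, hβ, hβR⟩, hα⟩ := ih
    obtain ⟨s, hts, hsq, hrow, hs⟩ : ∃ s, t ≤ s ∧ s ≤ q ∧
        (∀ j, t ≤ j → j < s → ¬ R p j) ∧ (s < q → R p s) := by
      by_cases h : ∃ s, t ≤ s ∧ s < q ∧ R p s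
      · have hspec := Nat.find_spec h
        refine ⟨Nat.find h, hspec.1, hspec.2.1.le, fun j htj hj hR => ?_, fun _ => hspec.2.2⟩
        exact Nat.find_min h hj ⟨htj, hj.trans hspec.2.1, hR⟩
      · exact ⟨q, htq, le_rfl, fun j htj hj hR => h ⟨j, htj, hj, hR⟩, fun hlt => by omega⟩
    refine ⟨s, hsq, ⟨fun j => if j < t then β j else p, ?_, ?_⟩, fun hlt => ?_⟩
    · intro j k hjk hk
      grind
    · intro j hj
      grind
    · obtain ⟨α, hmono, hαR⟩ := hα (hts.trans_lt hlt)
      refine ⟨fun i => if i < p then α i else s, ?_, ?_⟩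
      · intro i k hik hk
        grind
      · intro i hi
        grind

/-- A subset `F` of the grid `Fin p × Fin q` contains no vertical path if and only if
its complement contains a horizontal path. -/
theorem no_vertical_path_iff_complement_horizontal_path (p q : ℕ) (hp : 0 < p) (hq : 0 < q)
    (F : Set (Fin p × Fin q)) :
    (∀ α : Fin p → Fin q, Monotone α → ∃ i : Fin p, (i, α i) ∉ F) ↔
    (∃ β : Fin q → Fin p, Monotone β ∧ ∀ j : Fin q, (β j, j) ∉ F) := by
  constructor
  · intro h
    obtain ⟨t, htq, ⟨β, hβ, hβR⟩, hα⟩ := exists_horizontal_prefix_and_vertical_path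
      (fun i j => ∃ (hi : i < p) (hj : j < q), ((⟨i, hi⟩, ⟨j, hj⟩) : Fin p × Fin q) ∈ F) p q
    rcases htq.lt_or_eq with hlt | rfl
    · obtain ⟨α, hmono, hαR⟩ := hα hlt
      obtain ⟨i, hi⟩ := h (fun i => ⟨α i, (hαR i i.2).1.trans_lt hlt⟩)
        (fun i k hik => hmono i k hik k.2)
      obtain ⟨_, _, hF⟩ := (hαR i i.2).2
      exact absurd hF hi
    · exact ⟨fun j => ⟨β j, (hβR j j.2).1⟩, fun j k hjk => hβ j k hjk k.2,
        fun j hF => (hβR j j.2).2 ⟨(hβR j j.2).1, j.2, hF⟩⟩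
  · rintro ⟨β, hβ, hβF⟩ α hα
    have : Nonempty (Fin p) := ⟨⟨0, hp⟩⟩
    obtain ⟨i, hi⟩ := (hβ.comp hα).exists_fixedPoint_of_finite
    refine ⟨i, fun hF => hβF (α i) ?_⟩
    rwa [show β (α i) = i from hi]
end

section
/- Let p and q be positive integers and let X be the collection of all subsets of Fin p × Fin q that contain no vertical path (the graph of no nondecreasing function α : Fin p → Fin q is contained in them). Then the maximal elements of X under inclusion are exactly the complements of graphs of horizontal paths, i.e., a set F is a maximal element of X if and only if F = (Fin p × Fin q) \ graph(β) for some nondecreasing function β : Fin q → Fin p. -/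
/-- The graph of a vertical path `α : Fin p → Fin q`, as a subset of the grid. -/
def verticalGraph {p q : ℕ} (α : Fin p → Fin q) : Set (Fin p × Fin q) :=
  {x : Fin p × Fin q | x.2 = α x.1}

/-- The graph of a horizontal path `β : Fin q → Fin p`, as a subset of the grid. -/
def horizontalGraph {p q : ℕ} (β : Fin q → Fin p) : Set (Fin p × Fin q) :=
  {x : Fin p × Fin q | x.1 = β x.2}

/-- The simplicial complex `X` of subsets of the grid containing no vertical path. -/
def containsNoVerticalPath {p q : ℕ} (F : Set (Fin p × Fin q)) : Prop :=
  ∀ α : Fin p → Fin q, Monotone α → ¬ verticalGraph α ⊆ F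

/-- A monotone self-map of a nonempty `Fin p` has a fixed point. -/
theorem exists_fixed_point_of_monotone {p : ℕ} (hp : 0 < p) {f : Fin p → Fin p}
    (hf : Monotone f) : ∃ i, f i = i := by
  have hne : {i : Fin p | f i ≤ i}.Nonempty :=
    ⟨⟨p - 1, by omega⟩, Fin.le_def.2 (Nat.le_sub_one_of_lt (f _).isLt)⟩
  obtain ⟨i, hi, hmin⟩ := WellFounded.has_min (wellFounded_lt (α := Fin p)) _ hne
  exact ⟨i, le_antisymm hi (not_lt.1 fun hlt => hmin (f i) (hf hi) hlt)⟩

/-- Every vertical path meets every horizontal path. -/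
theorem containsNoVerticalPath_compl_horizontalGraph {p q : ℕ} (hp : 0 < p)
    {β : Fin q → Fin p} (hβ : Monotone β) :
    containsNoVerticalPath (Set.univ \ horizontalGraph β) := by
  intro α hα hsub
  obtain ⟨i, hi⟩ := exists_fixed_point_of_monotone hp (hβ.comp hα)
  exact (hsub (show (i, α i) ∈ verticalGraph α from rfl)).2 hi.symm

theorem exists_greedy_column {p q : ℕ} (F : Set (Fin p × Fin q)) (i m : ℕ) :
    ∃ j, m ≤ j ∧ ∀ (hi : i < p) (hj : j < q), ((⟨i, hi⟩, ⟨j, hj⟩) : Fin p × Fin q) ∈ F :=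
  ⟨max m q, le_max_left _ _, fun _ hj => absurd hj (not_lt.2 (le_max_right _ _))⟩

open Classical in
/-- The column reached after `i` steps by the path in `F` that in each row takes the first
available column; a value of at least `q` means that the path got stuck. -/
noncomputable def greedyColumn {p q : ℕ} (F : Set (Fin p × Fin q)) : ℕ → ℕ
  | 0 => 0
  | i + 1 => Nat.find (exists_greedy_column F i (greedyColumn F i))

theorem greedyColumn_monotone {p q : ℕ} (F : Set (Fin p × Fin q)) :
    Monotone (greedyColumn F) := by
  classical
  refine monotone_nat_of_le_succ fun i => ?_
  rw [greedyColumn]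
  exact (Nat.find_spec (exists_greedy_column F i (greedyColumn F i))).1

theorem greedyColumn_succ_mem {p q : ℕ} (F : Set (Fin p × Fin q)) (i : Fin p)
    (h : greedyColumn F (i + 1) < q) : (i, (⟨greedyColumn F (i + 1), h⟩ : Fin q)) ∈ F := by
  classical
  have key : ∀ hj : greedyColumn F (i + 1) < q,
      (i, (⟨greedyColumn F (i + 1), hj⟩ : Fin q)) ∈ F := by
    rw [greedyColumn]
    exact (Nat.find_spec (exists_greedy_column F i (greedyColumn F i))).2 i.isLt
  exact key h

theorem notMem_of_greedyColumn_le_of_lt {p q : ℕ} (F : Set (Fin p × Fin q)) (i : Fin p)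
    (j : Fin q) (hle : greedyColumn F i ≤ j) (hlt : (j : ℕ) < greedyColumn F (i + 1)) :
    (i, j) ∉ F := by
  classical
  intro hF
  rw [greedyColumn] at hlt
  exact Nat.find_min _ hlt ⟨hle, fun _ _ => hF⟩

theorem le_greedyColumn_of_containsNoVerticalPath {p q : ℕ} {F : Set (Fin p × Fin q)}
    (hF : containsNoVerticalPath F) : q ≤ greedyColumn F p := by
  by_contra! h
  have hlt (i : Fin p) : greedyColumn F (i + 1) < q :=
    (greedyColumn_monotone F (Nat.succ_le_of_lt i.isLt)).trans_lt h
  refine hF (fun i => ⟨greedyColumn F (i + 1), hlt i⟩) (fun i i' hii' => ?_) ?_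
  · exact Fin.mk_le_mk.2 (greedyColumn_monotone F (Nat.succ_le_succ hii'))
  · rintro ⟨i, j⟩ (rfl : j = ⟨greedyColumn F (i + 1), hlt i⟩)
    exact greedyColumn_succ_mem F i (hlt i)

/-- The complement of a set containing no vertical path contains a horizontal path. -/
theorem exists_horizontalGraph_subset_compl {p q : ℕ} (hp : 0 < p) {F : Set (Fin p × Fin q)}
    (hF : containsNoVerticalPath F) :
    ∃ β : Fin q → Fin p, Monotone β ∧ horizontalGraph β ⊆ Fᶜ := by
  classical
  have hex (j : Fin q) : ∃ i, i < p ∧ (j : ℕ) < greedyColumn F (i + 1) :=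
    ⟨p - 1, by omega, by
      rw [Nat.sub_add_cancel hp]
      exact j.isLt.trans_le (le_greedyColumn_of_containsNoVerticalPath hF)⟩
  refine ⟨fun j => ⟨Nat.find (hex j), (Nat.find_spec (hex j)).1⟩, fun j j' hjj' => ?_, ?_⟩
  · exact Fin.mk_le_mk.2 (Nat.find_mono fun i hi => ⟨hi.1, lt_of_le_of_lt hjj' hi.2⟩)
  · rintro ⟨i, j⟩ (hi : i = _)
    have hi' : (i : ℕ) = Nat.find (hex j) := congrArg Fin.val hi
    refine notMem_of_greedyColumn_le_of_lt F i j ?_ (hi' ▸ (Nat.find_spec (hex j)).2)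
    by_contra! hlt
    rcases h0 : (i : ℕ) with _ | k
    · simp [h0, greedyColumn] at hlt
    · rw [h0] at hlt
      exact Nat.find_min (hex j) (m := k) (by omega) ⟨by omega, hlt⟩

theorem eq_of_horizontalGraph_subset {p q : ℕ} {β γ : Fin q → Fin p}
    (h : horizontalGraph β ⊆ horizontalGraph γ) : β = γ :=
  funext fun j => h (show (β j, j) ∈ horizontalGraph β from rfl)

/-- The facets of the complex `X` of subsets of `Fin p × Fin q` containing no vertical
path are exactly the complements of graphs of horizontal paths. -/
theorem facets_of_no_vertical_path_complex (p q : ℕ) (hp : 0 < p) (hq : 0 < q)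
    (F : Set (Fin p × Fin q)) :
    (containsNoVerticalPath F ∧
      ∀ G : Set (Fin p × Fin q), containsNoVerticalPath G → F ⊆ G → G = F) ↔
    (∃ β : Fin q → Fin p, Monotone β ∧ F = Set.univ \ horizontalGraph β) := by
  constructor
  · rintro ⟨hF, hmax⟩
    obtain ⟨β, hβ, hsub⟩ := exists_horizontalGraph_subset_compl hp hF
    exact ⟨β, hβ, (hmax _ (containsNoVerticalPath_compl_horizontalGraph hp hβ)
      fun x hx => ⟨trivial, fun hxβ => hsub hxβ hx⟩).symm⟩
  · rintro ⟨β, hβ, rfl⟩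
    refine ⟨containsNoVerticalPath_compl_horizontalGraph hp hβ, fun G hG hsub => ?_⟩
    obtain ⟨γ, -, hγ⟩ := exists_horizontalGraph_subset_compl hp hG
    have hγβ : γ = β := eq_of_horizontalGraph_subset fun x hx =>
      by_contra fun hxβ => hγ hx (hsub ⟨trivial, hxβ⟩)
    subst hγβ
    exact Set.Subset.antisymm (fun x hx => ⟨trivial, fun hxγ => hγ hxγ hx⟩) hsub
end

section
/- Let d and s be positive integers and let F₁, …, F_s be finite sets, each of cardinality d, such that for every j with 2 ≤ j ≤ s there exists i < j with |F_i ∩ F_j| ≥ d − 1. If the intersection F₁ ∩ F₂ ∩ ⋯ ∩ F_s is empty, then d ≤ s − 1. -/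
/-- If every `F j` with `j ≥ 1` meets some earlier `F i` in at least `d - 1` elements, then
`F 0, …, F k` have at least `d - k` elements in common. -/
theorem exists_subset_forall_le_card_add {α : Type*} [DecidableEq α] {d s : ℕ}
    {F : Fin s → Finset α} (hcard : ∀ j : Fin s, (F j).card = d)
    (hattach : ∀ j : Fin s, 0 < (j : ℕ) → ∃ i : Fin s, i < j ∧ d ≤ (F i ∩ F j).card + 1)
    (k : ℕ) (hk : k < s) :
    ∃ I : Finset α, (∀ j : Fin s, (j : ℕ) ≤ k → I ⊆ F j) ∧ d ≤ I.card + k := by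
  induction k with
  | zero =>
    refine ⟨F ⟨0, hk⟩, fun j hj => ?_, by simp [hcard]⟩
    rw [show j = ⟨0, hk⟩ from Fin.ext (Nat.le_zero.mp hj)]
  | succ k ih =>
    obtain ⟨I, hI, hIcard⟩ := ih (by omega)
    obtain ⟨i, hi, hicard⟩ := hattach ⟨k + 1, hk⟩ k.succ_pos
    have hIi : I ⊆ F i := hI i (Nat.lt_succ_iff.mp hi)
    refine ⟨I ∩ F ⟨k + 1, hk⟩, fun j hj => ?_, ?_⟩
    · rcases Nat.lt_or_eq_of_le hj with h | h
      · exact Finset.inter_subset_left.trans (hI j (Nat.lt_succ_iff.mp h))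
      · rw [show j = ⟨k + 1, hk⟩ from Fin.ext h]
        exact Finset.inter_subset_right
    · have hsdiff := Finset.card_le_card (Finset.sdiff_subset_sdiff hIi
        (Finset.Subset.refl (F ⟨k + 1, hk⟩)))
      have hsplit := Finset.card_sdiff_add_card_inter I (F ⟨k + 1, hk⟩)
      have hsplit_facet := Finset.card_sdiff_add_card_inter (F i) (F ⟨k + 1, hk⟩)
      have := hcard i
      omega


/-- If `F 0, …, F (s-1)` are finite sets of cardinality `d` such that every `F j`
(for `j ≥ 1`) meets some earlier `F i` in at least `d - 1` elements, and the common
intersection is empty, then `d ≤ s - 1`. -/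
theorem tree_facets_empty_intersection {α : Type*} [DecidableEq α]
    (d s : ℕ) (hd : 0 < d) (hs : 0 < s)
    (F : Fin s → Finset α)
    (hcard : ∀ j : Fin s, (F j).card = d)
    (hattach : ∀ j : Fin s, 0 < (j : ℕ) →
      ∃ i : Fin s, i < j ∧ (d : ℤ) - 1 ≤ ((F i ∩ F j).card : ℤ))
    (hempty : (⋂ j : Fin s, (F j : Set α)) = ∅) :
    d ≤ s - 1 := by
  obtain ⟨I, hI, hIcard⟩ := exists_subset_forall_le_card_add hcard
    (fun j hj => (hattach j hj).imp fun i hi => ⟨hi.1, by have := hi.2; omega⟩)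
    (s - 1) (by omega)
  have hIempty : I = ∅ := by
    refine Finset.eq_empty_of_forall_notMem fun x hx => ?_
    have hmem : x ∈ ⋂ j : Fin s, (F j : Set α) :=
      Set.mem_iInter.mpr fun j => hI j (by omega) hx
    simp [hempty] at hmem
  simpa [hIempty] using hIcard
end

section
/- Let f(t) = 1 + f₁t + f₂t² + ⋯ be a polynomial with integer coefficients and constant term 1, let a = f₁, and suppose c ≥ 1 is the largest integer such that fᵢ = binomial(a, i) for all 0 ≤ i ≤ c (so the coefficient of t^{c+1} in f differs from binomial(a, c+1), where coefficients beyond the degree of f are 0). Let g(t) = (1+t)·f(t) with coefficients gᵢ and b = g₁ = a + 1. Then c is also the largest integer such that gᵢ = binomial(b, i) for all 0 ≤ i ≤ c; that is, gᵢ = binomial(a+1, i) for i ≤ c and the coefficient of t^{c+1} in g differs from binomial(a+1, c+1). -/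
open Polynomial

theorem coeff_one_add_X_mul_succ {R : Type*} [Semiring R] (f : R[X]) (k : ℕ) :
    ((1 + X) * f).coeff (k + 1) = f.coeff k + f.coeff (k + 1) := by
  rw [add_mul, one_mul, coeff_add, coeff_X_mul, add_comm]

/-- If `c ≥ 1` is the largest integer such that the coefficients of `f` up to degree `c`
agree with those of `(1+t)^{f₁}` (i.e. `fᵢ = binom(a, i)` for `i ≤ c`, where `a = f₁`),
then `c` is also the largest such integer for `g = (1+t)·f`, whose linear coefficient is
`b = a + 1`. -/
theorem invariant_c_stable_under_cone (f : Polynomial ℤ) (hf0 : f.coeff 0 = 1)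
    (a : ℤ) (ha : a = f.coeff 1) (c : ℕ) (hc : 1 ≤ c)
    (hupto : ∀ i : ℕ, i ≤ c → f.coeff i = Ring.choose a i)
    (hfail : f.coeff (c + 1) ≠ Ring.choose a (c + 1)) :
    (((1 + X) * f).coeff 1 = a + 1) ∧
    (∀ i : ℕ, i ≤ c → ((1 + X) * f).coeff i = Ring.choose (a + 1) i) ∧
    ((1 + X) * f).coeff (c + 1) ≠ Ring.choose (a + 1) (c + 1) := by
  refine ⟨?_, ?_, ?_⟩
  · rw [coeff_one_add_X_mul_succ f 0, hf0, ha, add_comm]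
  · rintro (_ | k) hk
    · simp [hf0]
    · rw [coeff_one_add_X_mul_succ, Ring.choose_succ_succ, hupto k (by omega), hupto (k + 1) hk]
  · rw [coeff_one_add_X_mul_succ, Ring.choose_succ_succ, hupto c le_rfl]
    exact fun h => hfail (add_left_cancel h)
end

section
/- Let k be a field, n a positive integer, E the exterior algebra over k on a vector space with basis e₁, …, e_n, and for a subset F = {i₁ < i₂ < ⋯ < i_r} of {1, …, n} let e_F = e_{i₁} ∧ e_{i₂} ∧ ⋯ ∧ e_{i_r}. Let Δ be a simplicial complex on {1, …, n} (a collection of subsets closed under taking subsets) and let I_Δ be the two-sided ideal of E generated by the monomials e_F for F ∉ Δ. Let Δ* = {F ⊆ {1,…,n} : {1,…,n} \ F ∉ Δ} be the Alexander dual. Then the annihilator {x ∈ E : x · y = 0 for all y ∈ I_Δ} equals I_{Δ*}. -/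
/-- The exterior monomial `e_F = e_{i₁} ∧ ⋯ ∧ e_{i_r}` associated to a subset
`F = {i₁ < ⋯ < i_r}` of `{1, …, n}`, inside the exterior algebra on the vector space
`Fin n → k` with its standard basis. -/
noncomputable def exteriorMonomial (k : Type*) [Field k] (n : ℕ) (F : Finset (Fin n)) :
    ExteriorAlgebra k (Fin n → k) :=
  ((F.sort (· ≤ ·)).map fun i => ExteriorAlgebra.ι k (Pi.single i (1 : k))).prod

/-- The Stanley-Reisner ideal of a simplicial complex `Δ` on `{1, …, n}` in the
exterior algebra: the two-sided ideal generated by the monomials `e_F` for `F ∉ Δ`. -/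
noncomputable def exteriorStanleyReisnerIdeal (k : Type*) [Field k] (n : ℕ)
    (Δ : Set (Finset (Fin n))) : TwoSidedIdeal (ExteriorAlgebra k (Fin n → k)) :=
  TwoSidedIdeal.span {z | ∃ F ∉ Δ, z = exteriorMonomial k n F}

/-- The Alexander dual `Δ* = {F : [n] \ F ∉ Δ}`. -/
def alexanderDual {n : ℕ} (Δ : Set (Finset (Fin n))) : Set (Finset (Fin n)) :=
  {F | Fᶜ ∉ Δ}

open Set.powersetCard in
lemma exteriorMonomial_eq_basis (k : Type*) [Field k] (n : ℕ) (F : Finset (Fin n)) :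
    exteriorMonomial k n F = (Pi.basisFun k (Fin n)).ExteriorAlgebra F := by
  rw [ExteriorAlgebra.basis_apply_ofCard _ (rfl : F.card = F.card), exteriorMonomial,
    ExteriorAlgebra.ιMulti_family, ExteriorAlgebra.ιMulti_apply,
    ← Finset.listMap_orderEmbOfFin_finRange F rfl, List.map_map, List.ofFn_eq_map]
  congr 1
  refine List.map_congr_left fun i _ => ?_
  simp [ofFinEmbEquiv_symm_apply, ofCard]

namespace ExteriorAlgebra

variable {R M I : Type*} [LinearOrder I] [CommRing R] [AddCommGroup M] [Module R M]

lemma basis_mul_eq_zero (b : Module.Basis I R M) {F G : Finset I} (h : ¬Disjoint F G) :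
    b.ExteriorAlgebra F * b.ExteriorAlgebra G = 0 :=
  basis_mul_of_not_disjoint b (Set.powersetCard.ofCard (rfl : F.card = F.card))
    (Set.powersetCard.ofCard (rfl : G.card = G.card)) h

lemma exists_basis_mul_eq_smul (b : Module.Basis I R M) {F G : Finset I} (h : Disjoint F G) :
    ∃ u : ℤˣ, b.ExteriorAlgebra F * b.ExteriorAlgebra G = u • b.ExteriorAlgebra (F ∪ G) := by
  rw [← Finset.disjUnion_eq_union F G h]
  exact ⟨_, basis_mul_of_disjoint b (Set.powersetCard.ofCard (rfl : F.card = F.card))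
    (Set.powersetCard.ofCard (rfl : G.card = G.card)) h⟩

/-- The coefficient of `e_H` in `e_F ∧ e_G` vanishes unless `H` is the disjoint union of
`F` and `G`. -/
lemma basis_repr_mul_eq_zero (b : Module.Basis I R M) {F G H : Finset I}
    (h : Disjoint F G → F ∪ G ≠ H) :
    b.ExteriorAlgebra.repr (b.ExteriorAlgebra F * b.ExteriorAlgebra G) H = 0 := by
  by_cases hd : Disjoint F G
  · obtain ⟨u, hu⟩ := exists_basis_mul_eq_smul b hd
    rw [hu, Units.smul_def, map_zsmul, Module.Basis.repr_self, Finsupp.smul_apply,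
      Finsupp.single_eq_of_ne' (h hd), smul_zero]
  · rw [basis_mul_eq_zero b hd, map_zero, Finsupp.zero_apply]

lemma repr_mul_apply [Fintype I] (b : Module.Basis I R M) (x y : ExteriorAlgebra R M)
    (H : Finset I) :
    b.ExteriorAlgebra.repr (x * y) H =
      ∑ F, ∑ G, b.ExteriorAlgebra.repr x F * (b.ExteriorAlgebra.repr y G *
        b.ExteriorAlgebra.repr (b.ExteriorAlgebra F * b.ExteriorAlgebra G) H) := by
  conv_lhs => rw [← b.ExteriorAlgebra.sum_repr x, ← b.ExteriorAlgebra.sum_repr y]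
  simp only [Finset.sum_mul_sum, map_sum, Finsupp.finsetSum_apply, smul_mul_assoc,
    mul_smul_comm, map_smul, Finsupp.smul_apply, smul_eq_mul, mul_left_comm]

/-- The coefficient of the top monomial in `x ∧ e_{Fᶜ}` is, up to sign, the coefficient of `e_F`
in `x`. -/
lemma exists_repr_mul_basis_compl [Fintype I] (b : Module.Basis I R M)
    (x : ExteriorAlgebra R M) (F : Finset I) :
    ∃ u : ℤˣ, b.ExteriorAlgebra.repr (x * b.ExteriorAlgebra Fᶜ) Finset.univ =
      u • b.ExteriorAlgebra.repr x F := by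
  obtain ⟨u, hu⟩ := exists_basis_mul_eq_smul b (disjoint_compl_right (a := F))
  refine ⟨u, ?_⟩
  conv_lhs => rw [← b.ExteriorAlgebra.sum_repr x]
  simp only [Finset.sum_mul, map_sum, Finsupp.finsetSum_apply, smul_mul_assoc,
    map_smul, Finsupp.smul_apply, smul_eq_mul]
  rw [Finset.sum_eq_single F]
  · rw [hu, Units.smul_def, map_zsmul, Module.Basis.repr_self, Finset.union_compl]
    simp [Units.smul_def, mul_comm]
  · intro G _ hG
    rw [basis_repr_mul_eq_zero b, mul_zero]
    intro hd hU
    exact hG (by simpa using (IsCompl.of_eq hd.eq_bot hU).eq_compl)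
  · simp

end ExteriorAlgebra

open ExteriorAlgebra in
/-- Elements of `I_Δ` are those whose coefficients at all faces of `Δ` vanish. -/
lemma mem_exteriorStanleyReisnerIdeal_iff {k : Type*} [Field k] {n : ℕ}
    {Δ : Set (Finset (Fin n))} (hΔ : ∀ F ∈ Δ, ∀ G ⊆ F, G ∈ Δ)
    {x : ExteriorAlgebra k (Fin n → k)} :
    x ∈ exteriorStanleyReisnerIdeal k n Δ ↔
      ∀ F ∈ Δ, (Pi.basisFun k (Fin n)).ExteriorAlgebra.repr x F = 0 := by
  constructor
  · intro hx
    induction hx using TwoSidedIdeal.span_induction with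
    | mem x h =>
      obtain ⟨G, hG, rfl⟩ := h
      intro F hF
      rw [exteriorMonomial_eq_basis, Module.Basis.repr_self,
        Finsupp.single_eq_of_ne (by rintro rfl; exact hG hF)]
    | zero => simp
    | add x y _ _ hx hy => intro F hF; simp [hx F hF, hy F hF]
    | neg x _ hx => intro F hF; simp [hx F hF]
    | left_absorb a x _ hx =>
      intro H hH
      rw [repr_mul_apply]
      refine Finset.sum_eq_zero fun F _ => Finset.sum_eq_zero fun G _ => ?_
      by_cases hG : G ∈ Δ
      · rw [hx G hG, zero_mul, mul_zero]
      · rw [basis_repr_mul_eq_zero, mul_zero, mul_zero]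
        rintro - rfl
        exact hG (hΔ _ hH _ Finset.subset_union_right)
    | right_absorb a x _ hx =>
      intro H hH
      rw [repr_mul_apply]
      refine Finset.sum_eq_zero fun F _ => Finset.sum_eq_zero fun G _ => ?_
      by_cases hF : F ∈ Δ
      · rw [hx F hF, zero_mul]
      · rw [basis_repr_mul_eq_zero, mul_zero, mul_zero]
        rintro - rfl
        exact hF (hΔ _ hH _ Finset.subset_union_left)
  · intro hx
    rw [← (Pi.basisFun k (Fin n)).ExteriorAlgebra.sum_repr x]
    refine sum_mem fun F _ => ?_
    by_cases hF : F ∈ Δ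
    · rw [hx F hF, zero_smul]
      exact zero_mem _
    · rw [← exteriorMonomial_eq_basis, Algebra.smul_def]
      exact TwoSidedIdeal.mul_mem_left _ _ _ (TwoSidedIdeal.subset_span ⟨F, hF, rfl⟩)

lemma alexanderDual_subset_closed {n : ℕ} {Δ : Set (Finset (Fin n))}
    (hΔ : ∀ F ∈ Δ, ∀ G ⊆ F, G ∈ Δ) :
    ∀ F ∈ alexanderDual Δ, ∀ G ⊆ F, G ∈ alexanderDual Δ :=
  fun _ hF _ hGF hG => hF (hΔ _ hG _ (Finset.compl_subset_compl.2 hGF))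

/-- The annihilator of the exterior Stanley-Reisner ideal `I_Δ` is the exterior
Stanley-Reisner ideal `I_{Δ*}` of the Alexander dual. -/
theorem annihilator_stanleyReisner_eq_dual (k : Type*) [Field k] (n : ℕ) (hn : 0 < n)
    (Δ : Set (Finset (Fin n))) (hΔ : ∀ F ∈ Δ, ∀ G ⊆ F, G ∈ Δ) :
    {x : ExteriorAlgebra k (Fin n → k) |
        ∀ y ∈ exteriorStanleyReisnerIdeal k n Δ, x * y = 0}
      = (exteriorStanleyReisnerIdeal k n (alexanderDual Δ) :
          Set (ExteriorAlgebra k (Fin n → k))) := by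
  ext x
  rw [Set.mem_ofPred_eq, SetLike.mem_coe,
    mem_exteriorStanleyReisnerIdeal_iff (alexanderDual_subset_closed hΔ)]
  constructor
  · intro hx F hF
    obtain ⟨u, hu⟩ := ExteriorAlgebra.exists_repr_mul_basis_compl (Pi.basisFun k (Fin n)) x F
    rw [← exteriorMonomial_eq_basis, hx _ (TwoSidedIdeal.subset_span ⟨Fᶜ, hF, rfl⟩), map_zero,
      Finsupp.zero_apply, eq_comm, smul_eq_zero_iff_eq] at hu
    exact hu
  · intro hx y hy
    rw [mem_exteriorStanleyReisnerIdeal_iff hΔ] at hy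
    refine (Pi.basisFun k (Fin n)).ExteriorAlgebra.ext_elem fun H => ?_
    rw [ExteriorAlgebra.repr_mul_apply, map_zero, Finsupp.zero_apply]
    refine Finset.sum_eq_zero fun F _ => Finset.sum_eq_zero fun G _ => ?_
    by_cases hF : F ∈ alexanderDual Δ
    · rw [hx F hF, zero_mul]
    by_cases hG : G ∈ Δ
    · rw [hy G hG, zero_mul, mul_zero]
    · rw [ExteriorAlgebra.basis_mul_eq_zero, map_zero, Finsupp.zero_apply, mul_zero, mul_zero]
      intro hd
      exact hG (hΔ _ (not_not.1 hF) _ (Finset.subset_compl_iff_disjoint_left.2 hd))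
end

section
/- Let p and q be positive integers and let X be the simplicial complex of all subsets of Fin p × Fin q containing no vertical path. Then X is not a cone: for every element v ∈ Fin p × Fin q there exists a maximal element F of X (under inclusion) with v ∉ F. Equivalently, for every (i, j) ∈ Fin p × Fin q there exists a nondecreasing function β : Fin q → Fin p with β(j) = i, and the complement of the graph of β is a facet of X not containing (i, j). -/
/-- The complex `X` of subsets of `Fin p × Fin q` containing no vertical path is not a
cone: for every vertex `v = (i, j)` there is a nondecreasing `β : Fin q → Fin p` with
`β j = i` such that the complement of the graph of `β` is a maximal element (facet) of
`X` not containing `v`. -/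
theorem no_vertical_path_complex_not_cone (p q : ℕ) (hp : 0 < p) (hq : 0 < q)
    (v : Fin p × Fin q) :
    ∃ β : Fin q → Fin p, Monotone β ∧ β v.2 = v.1 ∧
      (containsNoVerticalPath (Set.univ \ horizontalGraph β) ∧
        ∀ G : Set (Fin p × Fin q), containsNoVerticalPath G →
          Set.univ \ horizontalGraph β ⊆ G → G = Set.univ \ horizontalGraph β) ∧
      v ∉ Set.univ \ horizontalGraph β := by
  refine ⟨fun _ => v.1, monotone_const, rfl, ⟨?_, ?_⟩, fun h => h.2 rfl⟩
  · intro α _ hα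
    exact (hα (show (v.1, α v.1) ∈ verticalGraph α from rfl)).2 rfl
  · intro G hG hsub
    refine (Set.Subset.antisymm hsub ?_).symm
    rintro ⟨i, j⟩ hx
    refine ⟨trivial, fun (hi : i = v.1) => hG (fun _ => j) monotone_const ?_⟩
    rintro ⟨a, b⟩ (rfl : b = j)
    by_cases ha : a = v.1
    · rwa [ha, ← hi]
    · exact hsub ⟨trivial, ha⟩
end

section
/- Let Δ be a nonempty simplicial complex on [n] = {1, …, n} with [n] ∉ Δ, let d ≥ 1 be the maximum cardinality of a face of Δ, and let c be the largest integer such that every subset of [n] of cardinality c is a face of Δ. Define the h-vector of Δ by the polynomial identity t^d + f₀t^{d−1} + ⋯ + f_{d−1} = (1+t)^d + h₁(1+t)^{d−1} + ⋯ + h_d, where f_i is the number of faces of Δ of cardinality i+1, and define the h-vector of the Alexander dual Δ* = {F ⊆ [n] : [n] \ F ∉ Δ} analogously. If all entries of the h-vector of Δ and all entries of the h-vector of Δ* are nonnegative, then, setting s = n − d + c, the f-polynomial of Δ factors as f_Δ(t) = (1+t)^{n−s} · (1 + s·t + binomial(s,2)t² + ⋯ + binomial(s,c)t^c). -/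
open Polynomial

theorem reflect_one_add_X_pow (m : ℕ) :
    reflect m ((1 + X : ℤ[X]) ^ m) = (1 + X) ^ m := by
  induction m with
  | zero => rw [pow_zero, ← C_1, reflect_C, pow_zero, mul_one]
  | succ m ih =>
    have hdeg : ((1 + X : ℤ[X]) ^ m).natDegree ≤ m := by
      compute_degree
    have hdeg' : (1 + X : ℤ[X]).natDegree ≤ 1 := by compute_degree
    have hone : reflect 1 (1 + X : ℤ[X]) = 1 + X := by
      rw [reflect_add, ← C_1, reflect_C, reflect_one_X]
      simp [add_comm]
    rw [pow_succ, reflect_mul _ _ hdeg hdeg', ih, hone]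

theorem reflect_sum {ι : Type*} (N : ℕ) (s : Finset ι) (p : ι → ℤ[X]) :
    reflect N (∑ i ∈ s, p i) = ∑ i ∈ s, reflect N (p i) := by
  classical
  induction s using Finset.induction_on with
  | empty => simp
  | insert a s ha ih => rw [Finset.sum_insert ha, Finset.sum_insert ha, reflect_add, ih]

/-- The `h`-vector identity, rewritten as an expansion of the `f`-polynomial. -/
theorem f_polynomial_eq_of_h_vector {e : ℕ} {a h : ℕ → ℤ}
    (hah : ∑ i ∈ Finset.range (e + 1), C (a i) * X ^ (e - i)
      = ∑ i ∈ Finset.range (e + 1), C (h i) * (1 + X) ^ (e - i)) :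
    ∑ i ∈ Finset.range (e + 1), C (a i) * X ^ i
      = ∑ i ∈ Finset.range (e + 1), C (h i) * (X ^ i * (1 + X) ^ (e - i)) := by
  have key := congrArg (reflect e) hah
  rw [reflect_sum, reflect_sum] at key
  convert key using 1
  · refine Finset.sum_congr rfl fun i hi => ?_
    have hi : i ≤ e := Nat.lt_succ_iff.mp (Finset.mem_range.mp hi)
    rw [reflect_C_mul_X_pow, revAt_le (Nat.sub_le _ _), Nat.sub_sub_self hi]
  · refine Finset.sum_congr rfl fun i hi => ?_
    have hi : i ≤ e := Nat.lt_succ_iff.mp (Finset.mem_range.mp hi)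
    have hdeg : ((1 + X : ℤ[X]) ^ (e - i)).natDegree ≤ e - i := by compute_degree
    have hmul := reflect_mul (1 : ℤ[X]) _ (F := i) (by simp) hdeg
    rw [one_mul, Nat.add_sub_cancel' hi, reflect_one_add_X_pow, ← C_1, reflect_C, C_1,
      one_mul] at hmul
    rw [reflect_C_mul, hmul]

theorem X_pow_dvd_one_add_X_pow_sub_sum {N k m : ℕ} (hkm : k ≤ m) (a : ℕ → ℤ)
    (ha : ∀ i ≤ k, a i = (N.choose i : ℤ)) :
    X ^ (k + 1) ∣ (1 + X : ℤ[X]) ^ N - ∑ i ∈ Finset.range (m + 1), C (a i) * X ^ i := by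
  rw [X_pow_dvd_iff]
  intro i hi
  have him : i < m + 1 := by omega
  simp [coeff_one_add_X_pow, coeff_X_pow, him, ha i (by omega)]

/-- If the first coefficients `a i`, `i ≤ k`, of an `f`-polynomial are binomial coefficients,
then the part of its `h`-expansion of index at most `k` is determined. -/
theorem f_polynomial_eq_add_tail {N e k : ℕ} (hke : k ≤ e) (heN : e ≤ N) {a h : ℕ → ℤ}
    (ha : ∀ i ≤ k, a i = (N.choose i : ℤ))
    (hah : ∑ i ∈ Finset.range (e + 1), C (a i) * X ^ (e - i)
      = ∑ i ∈ Finset.range (e + 1), C (h i) * (1 + X) ^ (e - i)) :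
    ∑ i ∈ Finset.range (e + 1), C (a i) * X ^ i
      = (1 + X) ^ (e - k) *
          ∑ i ∈ Finset.range (k + 1), C (((N - e + k).choose i : ℤ)) * X ^ i
        + ∑ i ∈ Finset.Ico (k + 1) (e + 1), C (h i) * (X ^ i * (1 + X) ^ (e - i)) := by
  have hF := f_polynomial_eq_of_h_vector hah
  set Q : ℤ[X] := ∑ i ∈ Finset.range (k + 1), C (h i) * (X ^ i * (1 + X) ^ (k - i)) with hQ
  set S : ℤ[X] := ∑ i ∈ Finset.range (k + 1), C (((N - e + k).choose i : ℤ)) * X ^ i with hS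
  set R : ℤ[X] := ∑ i ∈ Finset.Ico (k + 1) (e + 1), C (h i) * (X ^ i * (1 + X) ^ (e - i))
    with hR
  have hsplit : ∑ i ∈ Finset.range (e + 1), C (a i) * X ^ i = (1 + X) ^ (e - k) * Q + R := by
    rw [hF, ← Finset.sum_range_add_sum_Ico _ (show k + 1 ≤ e + 1 by omega), hQ, Finset.mul_sum]
    congr 1
    refine Finset.sum_congr rfl fun i hi => ?_
    have hi : i ≤ k := Nat.lt_succ_iff.mp (Finset.mem_range.mp hi)
    rw [show e - i = (e - k) + (k - i) by omega, pow_add]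
    ring
  have hRdvd : X ^ (k + 1) ∣ R := Finset.dvd_sum fun i hi =>
    ((pow_dvd_pow X (Finset.mem_Ico.mp hi).1).mul_right _).mul_left _
  have hFdvd := X_pow_dvd_one_add_X_pow_sub_sum hke a ha
  have hSdvd : X ^ (k + 1) ∣ (1 + X : ℤ[X]) ^ (N - e + k) - S :=
    X_pow_dvd_one_add_X_pow_sub_sum le_rfl _ fun _ _ => rfl
  have hdvd : X ^ (k + 1) ∣ (1 + X) ^ (e - k) * (Q - S) := by
    have hpow : (1 + X : ℤ[X]) ^ N = (1 + X) ^ (e - k) * (1 + X) ^ (N - e + k) := by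
      rw [← pow_add]; congr 1; omega
    have := ((hSdvd.mul_left ((1 + X) ^ (e - k))).sub hFdvd).sub hRdvd
    rw [hsplit, hpow] at this
    convert this using 1
    ring
  have hcop : IsCoprime ((X : ℤ[X]) ^ (k + 1)) ((1 + X) ^ (e - k)) :=
    IsCoprime.pow ⟨-1, 1, by ring⟩
  have hQS : Q - S = 0 := by
    have hdvd' := hcop.dvd_of_dvd_mul_left hdvd
    refine eq_zero_of_dvd_of_natDegree_lt hdvd' ?_
    rw [natDegree_X_pow, Nat.lt_succ_iff]
    refine (natDegree_sub_le _ _).trans (max_le ?_ ?_)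
    · refine natDegree_sum_le_of_forall_le _ _ fun i hi => ?_
      have hi : i ≤ k := Nat.lt_succ_iff.mp (Finset.mem_range.mp hi)
      compute_degree
      omega
    · refine natDegree_sum_le_of_forall_le _ _ fun i hi => ?_
      have hi : i ≤ k := Nat.lt_succ_iff.mp (Finset.mem_range.mp hi)
      compute_degree
      omega
  rw [hsplit, sub_eq_zero.mp hQS]

/-- The `f`-polynomial and the `h`-polynomial, with their terms of index `0` split off. -/
theorem h_identity_range_succ {e : ℕ} {a h : ℕ → ℤ} (ha : a 0 = 1)
    (hh : (X ^ e + ∑ i ∈ Finset.range e, C (a (i + 1)) * X ^ (e - 1 - i) : ℤ[X])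
      = (1 + X) ^ e + ∑ i ∈ Finset.Icc 1 e, C (h i) * (1 + X) ^ (e - i)) :
    ∑ i ∈ Finset.range (e + 1), C (a i) * X ^ (e - i)
      = ∑ i ∈ Finset.range (e + 1), C (Function.update h 0 1 i) * (1 + X) ^ (e - i) := by
  rw [Finset.sum_range_succ', Finset.sum_range_succ', add_comm,
    add_comm (∑ i ∈ Finset.range e, C (Function.update h 0 1 (i + 1)) * _)]
  have hIcc : ∑ i ∈ Finset.Icc 1 e, C (h i) * (1 + X : ℤ[X]) ^ (e - i)
      = ∑ i ∈ Finset.range e, C (h (i + 1)) * (1 + X) ^ (e - (i + 1)) := by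
    rw [show Finset.Icc 1 e = Finset.Ico 1 (e + 1) from rfl, Finset.sum_Ico_eq_sum_range]
    simp only [Nat.add_sub_cancel, Nat.add_comm 1]
  rw [hIcc] at hh
  have hsub : ∀ i, e - 1 - i = e - (i + 1) := fun i => by omega
  simpa [ha, hsub] using hh

theorem sum_card_filter_card {n e : ℕ} (𝒜 : Finset (Finset (Fin n)))
    (he : ∀ F ∈ 𝒜, F.card ≤ e) :
    ∑ i ∈ Finset.range (e + 1), ((𝒜.filter (fun F => F.card = i)).card : ℤ) = 𝒜.card := by
  rw [Finset.card_eq_sum_card_fiberwise (f := Finset.card) (t := Finset.range (e + 1))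
    fun F hF => by simpa [Nat.lt_succ_iff] using he F hF]
  push_cast
  rfl

theorem card_filter_card_of_forall_mem {n i : ℕ} (𝒜 : Finset (Finset (Fin n)))
    (hi : ∀ F : Finset (Fin n), F.card = i → F ∈ 𝒜) :
    ((𝒜.filter (fun F => F.card = i)).card : ℤ) = (n.choose i : ℤ) := by
  have : 𝒜.filter (fun F => F.card = i) = Finset.powersetCard i Finset.univ := by
    ext F
    simpa using hi F
  rw [this, Finset.card_powersetCard, Finset.card_univ, Fintype.card_fin]

theorem sum_choose_add_sum_choose (p q : ℕ) :
    ∑ i ∈ Finset.range (p + 1), (((p + q + 1).choose i : ℕ) : ℤ)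
      + ∑ i ∈ Finset.range (q + 1), (((p + q + 1).choose i : ℕ) : ℤ) = 2 ^ (p + q + 1) := by
  have h := Nat.sum_range_choose (p + q + 1)
  rw [← Finset.sum_range_add_sum_Ico _ (show p + 1 ≤ p + q + 1 + 1 by omega),
    Finset.sum_Ico_eq_sum_range, ← Finset.sum_range_reflect] at h
  rw [← Finset.sum_range_reflect (fun i => (((p + q + 1).choose i : ℕ) : ℤ)) (q + 1)]
  have hq : ∑ i ∈ Finset.range (q + 1), (p + q + 1).choose (q + 1 - 1 - i)
      = ∑ i ∈ Finset.range (p + q + 1 + 1 - (p + 1)), (p + q + 1).choose (p + 1 + i) := by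
    refine Finset.sum_congr (by congr 1; omega) fun i hi => ?_
    have := Finset.mem_range.mp hi
    exact (Nat.choose_symm_of_eq_add (by omega)).symm
  have hp := Finset.sum_range_reflect (fun i => (p + q + 1).choose i) (p + 1)
  rw [hp, ← hq] at h
  exact_mod_cast h

/-- If the numbers of faces of a complex and of its Alexander dual add up to `2 ^ n` and both
`h`-vectors are nonnegative, then the `h`-vector vanishes in all degrees above `c`. -/
theorem f_polynomial_eq_of_nonneg {n d c : ℕ} (hcd : c ≤ d) (hdn : d < n) {a b h k : ℕ → ℤ}
    (ha : ∀ i ≤ c, a i = (n.choose i : ℤ)) (hb : ∀ i ≤ n - d - 1, b i = (n.choose i : ℤ))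
    (hah : ∑ i ∈ Finset.range (d + 1), C (a i) * X ^ (d - i)
      = ∑ i ∈ Finset.range (d + 1), C (h i) * (1 + X) ^ (d - i))
    (hbk : ∑ i ∈ Finset.range (n - c - 1 + 1), C (b i) * X ^ (n - c - 1 - i)
      = ∑ i ∈ Finset.range (n - c - 1 + 1), C (k i) * (1 + X) ^ (n - c - 1 - i))
    (hh : ∀ i ∈ Finset.Icc 1 d, 0 ≤ h i) (hk : ∀ i ∈ Finset.Icc 1 (n - c - 1), 0 ≤ k i)
    (htotal : ∑ i ∈ Finset.range (d + 1), a i + ∑ i ∈ Finset.range (n - c - 1 + 1), b i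
      = 2 ^ n) :
    ∑ i ∈ Finset.range (d + 1), C (a i) * X ^ i = (1 + X) ^ (d - c) *
      ∑ i ∈ Finset.range (c + 1), C (((n - d + c).choose i : ℤ)) * X ^ i := by
  have hf := f_polynomial_eq_add_tail hcd hdn.le ha hah
  have hg := f_polynomial_eq_add_tail (show n - d - 1 ≤ n - c - 1 by omega) (by omega) hb hbk
  have hf1 := congrArg (eval 1) hf
  have hg1 := congrArg (eval 1) hg
  simp only [eval_add, eval_mul, eval_pow, eval_finsetSum, eval_C, eval_X, eval_one, one_pow,
    mul_one, one_mul, one_add_one_eq_two] at hf1 hg1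
  have hbin := sum_choose_add_sum_choose c (n - d - 1)
  rw [show c + (n - d - 1) + 1 = n - d + c by omega] at hbin
  rw [show n - c - 1 - (n - d - 1) = d - c by omega,
    show n - (n - c - 1) + (n - d - 1) = n - d + c by omega] at hg1
  have hpow : (2 : ℤ) ^ n = 2 ^ (d - c) * 2 ^ (n - d + c) := by
    rw [← pow_add]; congr 1; omega
  have hnn : ∀ i ∈ Finset.Ico (c + 1) (d + 1), 0 ≤ h i * 2 ^ (d - i) := by
    intro i hi
    rw [Finset.mem_Ico] at hi
    exact mul_nonneg (hh i (Finset.mem_Icc.mpr (by omega))) (by positivity)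
  have hnn' : ∀ i ∈ Finset.Ico (n - d - 1 + 1) (n - c - 1 + 1), 0 ≤ k i * 2 ^ (n - c - 1 - i) := by
    intro i hi
    rw [Finset.mem_Ico] at hi
    exact mul_nonneg (hk i (Finset.mem_Icc.mpr (by omega))) (by positivity)
  have htail : ∑ i ∈ Finset.Ico (c + 1) (d + 1), h i * 2 ^ (d - i) = 0 := by
    have h1 := Finset.sum_nonneg hnn
    have h2 := Finset.sum_nonneg hnn'
    rw [← hbin, mul_add] at hpow
    linarith
  rw [Finset.sum_eq_zero_iff_of_nonneg hnn] at htail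
  rw [hf, Finset.sum_eq_zero (s := Finset.Ico (c + 1) (d + 1)) fun i hi => by
    rw [(mul_eq_zero.mp (htail i hi)).resolve_right (by positivity), C_0, zero_mul], add_zero]

/-- If `Δ` is a simplicial complex on `[n]` of maximal face cardinality `d ≥ 1`, with
invariant `c` (the largest integer such that every subset of cardinality `c` is a face),
and both the `h`-vector of `Δ` and the `h`-vector of its Alexander dual
`Δ* = {F : Fᶜ ∉ Δ}` (defined by `t^d + f₀t^{d-1} + ⋯ + f_{d-1}
= (1+t)^d + h₁(1+t)^{d-1} + ⋯ + h_d`, and analogously for `Δ*` with its own maximal face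
cardinality `d*`) are nonnegative, then, with `s = n - d + c`, the `f`-polynomial of `Δ`
factors as `f_Δ(t) = (1+t)^{n-s} · (1 + st + binom(s,2)t² + ⋯ + binom(s,c)t^c)`. -/
theorem biCM_f_polynomial (n : ℕ) (hn : 0 < n)
    (Δ : Finset (Finset (Fin n)))
    (hne : Δ.Nonempty)
    (hΔ : ∀ F ∈ Δ, ∀ G ⊆ F, G ∈ Δ)
    (hproper : (Finset.univ : Finset (Fin n)) ∉ Δ)
    -- `d` is the maximum cardinality of a face of `Δ`, `d ≥ 1`
    (d : ℕ) (hd : 1 ≤ d)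
    (hd1 : ∃ F ∈ Δ, F.card = d) (hd2 : ∀ F ∈ Δ, F.card ≤ d)
    -- `c` is the largest integer such that every subset of cardinality `c` is a face
    (c : ℕ)
    (hc1 : ∀ F : Finset (Fin n), F.card = c → F ∈ Δ)
    (hc2 : ∃ F : Finset (Fin n), F.card = c + 1 ∧ F ∉ Δ)
    -- `ds` is the maximum cardinality of a face of the Alexander dual `Δ*`
    (ds : ℕ)
    (hds1 : ∃ F : Finset (Fin n), Fᶜ ∉ Δ ∧ F.card = ds)
    (hds2 : ∀ F : Finset (Fin n), Fᶜ ∉ Δ → F.card ≤ ds)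
    -- the `h`-vector of `Δ`
    (h : ℕ → ℤ)
    (hh : (X ^ d + ∑ i ∈ Finset.range d,
          C (((Δ.filter (fun F => F.card = i + 1)).card : ℤ)) * X ^ (d - 1 - i) :
            Polynomial ℤ)
        = (1 + X) ^ d + ∑ i ∈ Finset.Icc 1 d, C (h i) * (1 + X) ^ (d - i))
    -- the `h`-vector of the Alexander dual `Δ*`
    (hstar : ℕ → ℤ)
    (hhstar : (X ^ ds + ∑ i ∈ Finset.range ds,
          C (((Finset.univ.filter
              (fun F : Finset (Fin n) => Fᶜ ∉ Δ ∧ F.card = i + 1)).card : ℤ))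
            * X ^ (ds - 1 - i) : Polynomial ℤ)
        = (1 + X) ^ ds + ∑ i ∈ Finset.Icc 1 ds, C (hstar i) * (1 + X) ^ (ds - i))
    -- both `h`-vectors are nonnegative
    (hpos : ∀ i ∈ Finset.Icc 1 d, 0 ≤ h i)
    (hstarpos : ∀ i ∈ Finset.Icc 1 ds, 0 ≤ hstar i) :
    ((1 : Polynomial ℤ) + ∑ i ∈ Finset.range d,
        C (((Δ.filter (fun F => F.card = i + 1)).card : ℤ)) * X ^ (i + 1))
      = (1 + X) ^ (n - (n - d + c)) *
        ∑ i ∈ Finset.range (c + 1), C (((n - d + c).choose i : ℤ)) * X ^ i := by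
  have hle : ∀ i ≤ c, ∀ F : Finset (Fin n), F.card = i → F ∈ Δ := by
    intro i hi F hF
    obtain ⟨G₀, hG₀, -⟩ := hc2
    have hcn : c ≤ Fintype.card (Fin n) := by
      have := G₀.card_le_univ
      omega
    obtain ⟨G, hFG, hG⟩ := Finset.exists_superset_card_eq (hF.le.trans hi) hcn
    exact hΔ G (hc1 G hG) F hFG
  have hcard : ∀ F : Finset (Fin n), F.card ≤ n := fun F => by simpa using F.card_le_univ
  have hcompl : ∀ F : Finset (Fin n), Fᶜ.card = n - F.card := fun F => by
    rw [Finset.card_compl, Fintype.card_fin]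
  have hdn : d < n := by
    obtain ⟨F, hF, rfl⟩ := hd1
    refine lt_of_le_of_ne (hcard F) fun h => hproper ?_
    rwa [← (Finset.card_eq_iff_eq_univ F).mp (by simpa using h)]
  have hcn : c + 1 ≤ n := by
    obtain ⟨F, hF, -⟩ := hc2
    exact hF ▸ hcard F
  have hcd : c ≤ d := by
    obtain ⟨F, -, hF⟩ := Finset.exists_subset_card_eq
      (show c ≤ (Finset.univ : Finset (Fin n)).card by simp; omega)
    exact hF ▸ hd2 F (hc1 F hF)
  have hds : ds = n - c - 1 := by
    apply le_antisymm
    · obtain ⟨F, hF, rfl⟩ := hds1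
      by_contra hlt
      have := hcard F
      exact hF (hle _ (by rw [hcompl]; omega) _ rfl)
    · obtain ⟨F, hF, hFΔ⟩ := hc2
      have := hds2 Fᶜ (by rwa [compl_compl])
      rw [hcompl] at this
      omega
  set Δs : Finset (Finset (Fin n)) := Finset.univ.filter (fun F => Fᶜ ∉ Δ) with hΔs
  have hfilter : ∀ i, Finset.univ.filter (fun F : Finset (Fin n) => Fᶜ ∉ Δ ∧ F.card = i)
      = Δs.filter (fun F => F.card = i) := fun i => by
    rw [hΔs, Finset.filter_filter]
  simp only [hfilter] at hhstar
  have hles : ∀ i ≤ n - d - 1, ∀ F : Finset (Fin n), F.card = i → F ∈ Δs := by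
    intro i hi F hF
    rw [hΔs, Finset.mem_filter]
    refine ⟨Finset.mem_univ _, fun hmem => ?_⟩
    have := hd2 _ hmem
    rw [hcompl] at this
    omega
  have ha := fun i hi => card_filter_card_of_forall_mem Δ (hle i hi)
  have has := fun i hi => card_filter_card_of_forall_mem Δs (hles i hi)
  have ha0 := ha 0 (Nat.zero_le _)
  have has0 := has 0 (Nat.zero_le _)
  rw [Nat.choose_zero_right, Nat.cast_one] at ha0 has0
  have htotal : (Δ.card : ℤ) + Δs.card = 2 ^ n := by
    have hΔs' : Δs.card = Δᶜ.card := by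
      refine Finset.card_bij (fun F _ => Fᶜ) ?_ (fun _ _ _ _ h => compl_injective h) ?_
      · intro F hF
        simpa [hΔs] using hF
      · intro F hF
        exact ⟨Fᶜ, by simpa [hΔs] using hF, compl_compl F⟩
    have := Finset.card_add_card_compl Δ
    rw [← hΔs', Fintype.card_finset, Fintype.card_fin] at this
    exact_mod_cast this
  subst hds
  have hupd : ∀ {e : ℕ} {g : ℕ → ℤ}, (∀ i ∈ Finset.Icc 1 e, 0 ≤ g i) →
      ∀ i ∈ Finset.Icc 1 e, 0 ≤ Function.update g 0 1 i := fun hg i hi => by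
    rw [Function.update_of_ne (by have := (Finset.mem_Icc.mp hi).1; omega)]
    exact hg i hi
  rw [← sum_card_filter_card Δ hd2,
    ← sum_card_filter_card Δs fun F hF => hds2 F (Finset.mem_filter.mp hF).2] at htotal
  obtain ⟨a, hfa⟩ : ∃ a : ℕ → ℤ, ∀ i, ((Δ.filter (fun F => F.card = i)).card : ℤ) = a i :=
    ⟨_, fun _ => rfl⟩
  obtain ⟨b, hfb⟩ : ∃ b : ℕ → ℤ, ∀ i, ((Δs.filter (fun F => F.card = i)).card : ℤ) = b i :=
    ⟨_, fun _ => rfl⟩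
  simp only [hfa, hfb] at hh hhstar ha has ha0 has0 htotal ⊢
  have hf := f_polynomial_eq_of_nonneg hcd hdn ha has (h_identity_range_succ ha0 hh)
    (h_identity_range_succ has0 hhstar) (hupd hpos) (hupd hstarpos) htotal
  rw [Finset.sum_range_succ', ha0, C_1, pow_zero, mul_one, add_comm] at hf
  rw [hf, show n - (n - d + c) = d - c by omega]
end
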